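/- Let $R$ be a commutative ring, $n, m \geq 1$ and $k \geq 0$. Let $p_1, \dots, p_m$ be polynomials in $n$ variables over $R$, each with zero constant term (i.e. $p_j(0,\dots,0) = 0$). If $x = (x_1,\dots,x_n) \in D_k(n)$, then the tuple $(p_1(x), \dots, p_m(x))$ lies in $D_k(m)$; that is, every product of $k+1$ of the values $p_j(x)$ (repetitions allowed) equals $0$. -/

import Mathlib

theorem eval_sub_mem_aux {R : Type*} [CommRing R] {n : ℕ} (x : Fin n → R)
    (q : MvPolynomial (Fin n) R) :
    MvPolynomial.eval x q - MvPolynomial.eval (0 : Fin n → R) q ∈ Ideal.span (Set.range x) := by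
  induction q using MvPolynomial.induction_on with
  | C a => simp
  | add p q hp hq =>
    have := Ideal.add_mem _ hp hq
    simp only [map_add]
    convert this using 1
    ring
  | mul_X p i hp =>
    simp only [map_mul, MvPolynomial.eval_X, Pi.zero_apply, mul_zero, sub_zero]
    exact Ideal.mul_mem_left _ _ (Ideal.subset_span ⟨i, rfl⟩)

/-- Polynomial maps vanishing at `0` send `D_k(n)` into `D_k(m)`: if each `p j` has zero
constant term and `x ∈ D_k(n)`, then `(p 1 (x), …, p m (x)) ∈ D_k(m)`. -/
theorem polynomial_maps_Dkn_to_Dkm (R : Type*) [CommRing R] (n m k : ℕ)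
    (hn : 1 ≤ n) (hm : 1 ≤ m)
    (p : Fin m → MvPolynomial (Fin n) R)
    (hp : ∀ j : Fin m, MvPolynomial.eval (0 : Fin n → R) (p j) = 0)
    (x : Fin n → R) (hx : ∀ f : Fin (k + 1) → Fin n, ∏ j, x (f j) = 0) :
    ∀ f : Fin (k + 1) → Fin m, ∏ j, MvPolynomial.eval x (p (f j)) = 0 := by
  intro f
  have h : ∀ j, ∃ c : Fin n → R, ∑ i, c i * x i = MvPolynomial.eval x (p j) := by
    intro j
    have h := eval_sub_mem_aux x (p j)
    rw [hp, sub_zero] at h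
    exact Ideal.mem_span_range_iff_exists_fun.mp h
  choose c hc using h
  simp only [← hc]
  rw [Finset.prod_univ_sum]
  refine Finset.sum_eq_zero fun g _ => ?_
  rw [Finset.prod_mul_distrib, hx, mul_zero]
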